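/- Let A = (A_1,…,A_q) be a system of endomorphisms of V. For every multi-index u ∈ ℕ^q, the symmetric function σ_u satisfies |u|·σ_u(A) = Σ_{α=1}^q tr( A_α ∘ T_{α♭(u)}(A) ). -/

import Mathlib

open scoped BigOperators

namespace GNTPaper

variable {p q : ℕ}

/-- The Newton polynomial `P_A(t) = det(1_V + tA)` of a system of endomorphisms
(represented as matrices w.r.t. an orthonormal basis), as a multivariate
polynomial in the variables `t_1, …, t_q`. -/
noncomputable def newtonMvPoly (A : Fin q → Matrix (Fin p) (Fin p) ℝ) :
    MvPolynomial (Fin q) ℝ :=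
  Matrix.det (1 + ∑ α : Fin q, (MvPolynomial.X α : MvPolynomial (Fin q) ℝ) •
    (A α).map (fun x => (MvPolynomial.C x : MvPolynomial (Fin q) ℝ)))

/-- `σ_u(A)`: the coefficient of `t^u` in the Newton polynomial `P_A(t) = det(1 + tA)`. -/
noncomputable def sigma (A : Fin q → Matrix (Fin p) (Fin p) ℝ) (u : Fin q → ℕ) : ℝ :=
  MvPolynomial.coeff (Finsupp.equivFunOnFinite.symm u) (newtonMvPoly A)

/-- A matrix `i ∈ I(q,s)` (a `q × s` matrix of zeros and ones with exactly one `1`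
in each column) is encoded by the function `c : Fin s → Fin q` recording, for each
column `l`, the row `c l` containing its unique entry `1`.  `wt c α` is then the
weight `|i^α| = Σ_l i^α_l`, i.e. the number of columns whose `1` lies in row `α`. -/
def wt {s : ℕ} (c : Fin s → Fin q) (α : Fin q) : ℕ :=
  (Finset.univ.filter fun l => c l = α).card

/-- The ordered composition `A^i = A_{c(1)} ⬝ A_{c(2)} ⬝ ⋯ ⬝ A_{c(s)}` associated to a
matrix `i ∈ I(q,s)` encoded by `c : Fin s → Fin q` (`A^i = 1` for `s = 0`). -/
noncomputable def prodSeq (A : Fin q → Matrix (Fin p) (Fin p) ℝ) {s : ℕ}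
    (c : Fin s → Fin q) : Matrix (Fin p) (Fin p) ℝ :=
  (List.ofFn fun l => A (c l)).prod

/-- `σ_{u - |i|}(A)`, where by convention it is `0` whenever `u - |i|` has a
negative entry. -/
noncomputable def sigmaSub (A : Fin q → Matrix (Fin p) (Fin p) ℝ) (u : Fin q → ℕ)
    {s : ℕ} (c : Fin s → Fin q) : ℝ :=
  if ∀ α, wt c α ≤ u α then sigma A (fun α => u α - wt c α) else 0

/-- The generalized Newton transformation
`T_u(A) = Σ_{s=0}^{|u|} Σ_{i ∈ I(q,s)} (-1)^{‖i‖} σ_{u-|i|}(A) A^i`. -/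
noncomputable def gnt (A : Fin q → Matrix (Fin p) (Fin p) ℝ) (u : Fin q → ℕ) :
    Matrix (Fin p) (Fin p) ℝ :=
  ∑ s ∈ Finset.range ((∑ α, u α) + 1),
    (-1 : ℝ) ^ s • ∑ c : Fin s → Fin q, sigmaSub A u c • prodSeq A c

/-- `T_{α♭(u)}(A)`, with the convention that it is `0` when `u α = 0`. -/
noncomputable def gntFlat (A : Fin q → Matrix (Fin p) (Fin p) ℝ) (α : Fin q)
    (u : Fin q → ℕ) : Matrix (Fin p) (Fin p) ℝ :=
  if u α = 0 then 0 else gnt A (Function.update u α (u α - 1))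

/-- `σ_{α♭(u)}(A)`, with the convention that it is `0` when `u α = 0`. -/
noncomputable def sigmaFlat (A : Fin q → Matrix (Fin p) (Fin p) ℝ) (α : Fin q)
    (u : Fin q → ℕ) : ℝ :=
  if u α = 0 then 0 else sigma A (Function.update u α (u α - 1))

/-- The generalized Kronecker symbol `δ^{i_1…i_r}_{j_1…j_r}`, equal to `+1` (resp. `-1`)
if the `i`'s are distinct and the `j`'s are an even (resp. odd) permutation of the `i`'s,
and `0` otherwise; given by the classical determinant formula `det(δ_{i_k j_l})_{k,l}`. -/
noncomputable def gkron {n r : ℕ} (i j : Fin r → Fin n) : ℝ :=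
  Matrix.det (Matrix.of fun k l : Fin r => if i k = j l then (1 : ℝ) else 0)

/-- For `k < 2m`, the index `⌊k/2⌋ < m`; used to pair consecutive indices. -/
def halfIdx {m : ℕ} (k : Fin (2 * m)) : Fin m :=
  ⟨(k : ℕ) / 2, Nat.div_lt_of_lt_mul k.isLt⟩

/-- The scalar `S_r(A)` (for `r = 2m` even) from Reilly's construction. -/
noncomputable def Sr (A : Fin q → Matrix (Fin p) (Fin p) ℝ) (m : ℕ) : ℝ :=
  (1 / ((2 * m).factorial : ℝ)) *
    ∑ iv : Fin (2 * m) → Fin p, ∑ jv : Fin (2 * m) → Fin p,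
      gkron iv jv * ∑ a : Fin m → Fin q, ∏ k : Fin (2 * m), A (a (halfIdx k)) (iv k) (jv k)

/-- The Reilly operator `T_r(A)` (for `r = 2m` even). -/
noncomputable def TrReilly (A : Fin q → Matrix (Fin p) (Fin p) ℝ) (m : ℕ) :
    Matrix (Fin p) (Fin p) ℝ :=
  Matrix.of fun i j => (1 / ((2 * m).factorial : ℝ)) *
    ∑ iv : Fin (2 * m) → Fin p, ∑ jv : Fin (2 * m) → Fin p,
      gkron (Fin.snoc iv i) (Fin.snoc jv j) *
        ∑ a : Fin m → Fin q, ∏ k : Fin (2 * m), A (a (halfIdx k)) (iv k) (jv k)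

/-- The Reilly operator `T_{r+1}^α(A)` (for `r = 2m` even). -/
noncomputable def Tr1Reilly (A : Fin q → Matrix (Fin p) (Fin p) ℝ) (m : ℕ) (α : Fin q) :
    Matrix (Fin p) (Fin p) ℝ :=
  Matrix.of fun i j => (1 / ((2 * m).factorial : ℝ)) *
    ∑ iv : Fin (2 * m + 1) → Fin p, ∑ jv : Fin (2 * m + 1) → Fin p,
      gkron (Fin.snoc iv i) (Fin.snoc jv j) *
        (A α (iv (Fin.last (2 * m))) (jv (Fin.last (2 * m))) *
          ∑ a : Fin m → Fin q, ∏ k : Fin (2 * m),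
            A (a (halfIdx k)) (iv k.castSucc) (jv k.castSucc))

/-- The (finite) set of multi-indices `u ∈ 2ℕ(q)` with `|u| = r` (all entries even,
total length `r`). -/
noncomputable def evenIdx (q r : ℕ) : Finset (Fin q → ℕ) :=
  (Fintype.piFinset fun _ : Fin q => Finset.range (r + 1)).filter
    fun u => (∀ α, Even (u α)) ∧ ∑ α, u α = r

/-- A derivation applied to a finite product. -/
theorem derivation_prod {R S ι : Type*} [CommSemiring R] [CommSemiring S] [Algebra R S]
    [DecidableEq ι] (D : Derivation R S S) (s : Finset ι) (f : ι → S) :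
    D (∏ i ∈ s, f i) = ∑ i ∈ s, (∏ j ∈ s.erase i, f j) * D (f i) := by
  induction s using Finset.induction_on with
  | empty => simp
  | insert a s ha ih =>
    rw [Finset.prod_insert ha, D.leibniz, ih, Finset.sum_insert ha, Finset.erase_insert ha,
      smul_eq_mul, smul_eq_mul, Finset.mul_sum]
    refine (add_comm _ _).trans (congrArg _ ?_)
    refine Finset.sum_congr rfl fun i hi => ?_
    have hia : a ≠ i := fun h => ha (h ▸ hi)
    rw [Finset.erase_insert_of_ne hia, Finset.prod_insert (by simp [ha]), mul_assoc]

/-- Jacobi's formula for the derivative of a determinant. -/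
theorem derivation_det {R S n : Type*} [CommRing R] [CommRing S] [Algebra R S]
    [Fintype n] [DecidableEq n] (D : Derivation R S S) (M : Matrix n n S) :
    D M.det = (M.map D * M.adjugate).trace := by
  have hcol : ∀ i, (M.updateCol i fun j => D (M j i)).det = (M.adjugate * M.map D) i i := by
    intro i
    rw [← Matrix.cramer_apply, Matrix.cramer_eq_adjugate_mulVec]
    rfl
  rw [Matrix.trace_mul_comm, Matrix.trace]
  simp only [Matrix.diag_apply, ← hcol, Matrix.det_apply, map_sum]
  rw [Finset.sum_comm]
  refine Finset.sum_congr rfl fun g _ => ?_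
  rw [← Finset.smul_sum, map_zsmul_unit, derivation_prod]
  congr 1
  refine Finset.sum_congr rfl fun i _ => ?_
  rw [← Finset.prod_erase_mul _ _ (Finset.mem_univ i), Matrix.updateCol_self]
  congr 1
  refine Finset.prod_congr rfl fun j hj => ?_
  rw [Matrix.updateCol_ne (Finset.ne_of_mem_erase hj)]

/-- The Euler derivation `∑ i, X i * ∂/∂X i` multiplies the coefficient of a monomial by its
degree. -/
theorem coeff_euler {σ R : Type*} [CommSemiring R] (f : MvPolynomial σ R) (m : σ →₀ ℕ) :
    (MvPolynomial.mkDerivation R MvPolynomial.X f : MvPolynomial σ R).coeff m =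
      m.degree * f.coeff m := by
  classical
  induction f using MvPolynomial.induction_on' with
  | add f g hf hg => simp [hf, hg, mul_add]
  | monomial s r =>
    have h : (MvPolynomial.mkDerivation R MvPolynomial.X (MvPolynomial.monomial s r) :
        MvPolynomial σ R) = MvPolynomial.monomial s (r * s.degree) := by
      rw [MvPolynomial.mkDerivation_monomial, Finsupp.degree_apply, Finsupp.sum,
        Nat.cast_sum, Finset.mul_sum, map_sum, Finset.smul_sum]
      refine Finset.sum_congr rfl fun i hi => ?_
      have hle : Finsupp.single i 1 ≤ s := by
        rw [Finsupp.single_le_iff]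
        exact Nat.one_le_iff_ne_zero.2 (Finsupp.mem_support_iff.1 hi)
      rw [smul_eq_mul, MvPolynomial.X, MvPolynomial.monomial_mul, tsub_add_cancel_of_le hle,
        mul_one, MvPolynomial.smul_monomial, smul_eq_mul]
    rw [h, MvPolynomial.coeff_monomial, MvPolynomial.coeff_monomial]
    split_ifs with hs
    · rw [hs, mul_comm]
    · simp

/-- The generic linear combination `∑ α, t_α A_α`. -/
noncomputable def genericSum (A : Fin q → Matrix (Fin p) (Fin p) ℝ) :
    Matrix (Fin p) (Fin p) (MvPolynomial (Fin q) ℝ) :=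
  ∑ α : Fin q, (MvPolynomial.X α : MvPolynomial (Fin q) ℝ) •
    (A α).map (fun x => (MvPolynomial.C x : MvPolynomial (Fin q) ℝ))

theorem wt_cons {s : ℕ} (a : Fin q) (c : Fin s → Fin q) :
    Finsupp.equivFunOnFinite.symm (wt (Fin.cons a c : Fin (s + 1) → Fin q)) =
      Finsupp.single a 1 + Finsupp.equivFunOnFinite.symm (wt c) := by
  ext α
  simp only [Finsupp.add_apply, Finsupp.equivFunOnFinite_symm_apply_apply, wt,
    Fin.card_filter_univ_succ, Fin.cons_zero, Fin.cons_succ, Finsupp.single_apply]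
  split_ifs <;> simp [add_comm]

theorem sum_wt {s : ℕ} (c : Fin s → Fin q) : ∑ α, wt c α = s := by
  simpa [wt] using (Finset.card_eq_sum_card_fiberwise (s := Finset.univ) (t := Finset.univ)
    (f := c) (fun _ _ => Finset.mem_coe.2 (Finset.mem_univ _))).symm

theorem genericSum_pow (A : Fin q → Matrix (Fin p) (Fin p) ℝ) (s : ℕ) :
    genericSum A ^ s = ∑ c : Fin s → Fin q,
      MvPolynomial.monomial (Finsupp.equivFunOnFinite.symm (wt c)) (1 : ℝ) •
        (prodSeq A c).map MvPolynomial.C := by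
  induction s with
  | zero =>
    have h0 : ∀ c : Fin 0 → Fin q, Finsupp.equivFunOnFinite.symm (wt c) = 0 := fun c => by
      ext; simp [wt]
    have h1 : (1 : Matrix (Fin p) (Fin p) ℝ).map (MvPolynomial.C (σ := Fin q)) = 1 :=
      Matrix.map_one _ (map_zero _) (map_one _)
    simp [prodSeq, h0, h1]
  | succ s ih =>
    rw [pow_succ', ih, ← (Fin.consEquiv fun _ => Fin q).sum_comp, Fintype.sum_prod_type,
      genericSum, Finset.sum_mul_sum]
    refine Finset.sum_congr rfl fun a _ => Finset.sum_congr rfl fun c _ => ?_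
    have hp : prodSeq A (Fin.cons a c : Fin (s + 1) → Fin q) = A a * prodSeq A c := by
      simp [prodSeq, List.ofFn_succ]
    change _ = MvPolynomial.monomial (Finsupp.equivFunOnFinite.symm (wt (Fin.cons a c))) (1 : ℝ) •
      (prodSeq A (Fin.cons a c)).map MvPolynomial.C
    rw [wt_cons, hp, Matrix.map_mul, Matrix.smul_mul, Matrix.mul_smul, smul_smul,
      MvPolynomial.X, MvPolynomial.monomial_mul, one_mul]

theorem coeff_newtonMvPoly_mul_genericSum_pow (A : Fin q → Matrix (Fin p) (Fin p) ℝ)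
    (u : Fin q → ℕ) (s : ℕ) (i j : Fin p) :
    (newtonMvPoly A * (genericSum A ^ s) i j).coeff (Finsupp.equivFunOnFinite.symm u) =
      ∑ c : Fin s → Fin q, sigmaSub A u c * prodSeq A c i j := by
  rw [genericSum_pow, Matrix.sum_apply, Finset.mul_sum, MvPolynomial.coeff_sum]
  refine Finset.sum_congr rfl fun c _ => ?_
  rw [Matrix.smul_apply, Matrix.map_apply, smul_eq_mul, ← mul_assoc, mul_comm, MvPolynomial.coeff_C_mul,
    MvPolynomial.coeff_mul_monomial', mul_one, mul_comm]
  refine congrArg (· * _) (if_congr Iff.rfl ?_ rfl)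
  exact congrArg (MvPolynomial.coeff · (newtonMvPoly A)) (Finsupp.ext fun _ => rfl)

theorem coeff_mul_genericSum_pow_of_lt (A : Fin q → Matrix (Fin p) (Fin p) ℝ)
    (u : Fin q → ℕ) {s : ℕ} (hs : ∑ α, u α < s)
    (N : Matrix (Fin p) (Fin p) (MvPolynomial (Fin q) ℝ)) (i j : Fin p) :
    ((N * genericSum A ^ s) i j).coeff (Finsupp.equivFunOnFinite.symm u) = 0 := by
  rw [genericSum_pow, Finset.mul_sum, Matrix.sum_apply, MvPolynomial.coeff_sum]
  refine Finset.sum_eq_zero fun c _ => ?_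
  rw [Matrix.mul_smul, Matrix.smul_apply, smul_eq_mul, MvPolynomial.coeff_monomial_mul', if_neg]
  intro hle
  have := Finset.sum_le_sum fun α (_ : α ∈ Finset.univ) => hle α
  rw [← sum_wt c] at hs
  exact absurd hs this.not_gt

/-- The truncated geometric series for the adjugate of `1 + B`. -/
theorem adjugate_one_add {R n : Type*} [CommRing R] [Fintype n] [DecidableEq n]
    (B : Matrix n n R) (k : ℕ) :
    (1 + B).adjugate = ∑ s ∈ Finset.range k, (-1 : R) ^ s • (1 + B).det • B ^ s +
      (-1 : R) ^ k • ((1 + B).adjugate * B ^ k) := by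
  induction k with
  | zero => simp
  | succ k ih =>
    have h : (1 + B).adjugate = (1 + B).det • 1 - (1 + B).adjugate * B := by
      rw [eq_sub_iff_add_eq, ← Matrix.adjugate_mul, mul_add, mul_one]
    have h' : (1 + B).adjugate * B ^ k =
        (1 + B).det • B ^ k - (1 + B).adjugate * B ^ (k + 1) := by
      conv_lhs => rw [h]
      rw [sub_mul, Matrix.smul_mul, one_mul, pow_succ', mul_assoc]
    conv_lhs => rw [ih]
    rw [h', Finset.sum_range_succ, pow_succ (-1 : R), mul_neg_one, neg_smul, smul_sub]
    abel

/-- The generalized Newton transformation `T_u` is the coefficient of `t^u` in the adjugate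
of `1 + tA`. -/
theorem gnt_apply (A : Fin q → Matrix (Fin p) (Fin p) ℝ) (u : Fin q → ℕ) (i j : Fin p) :
    gnt A u i j =
      ((1 + genericSum A).adjugate i j).coeff (Finsupp.equivFunOnFinite.symm u) := by
  have hsign : ∀ (s : ℕ) (f : MvPolynomial (Fin q) ℝ) m,
      ((-1 : MvPolynomial (Fin q) ℝ) ^ s * f).coeff m = (-1) ^ s * f.coeff m := fun s f m => by
    rw [← MvPolynomial.coeff_C_mul, map_pow, map_neg, map_one]
  rw [adjugate_one_add (genericSum A) (∑ α, u α + 1), Matrix.add_apply, MvPolynomial.coeff_add,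
    Matrix.smul_apply, smul_eq_mul, hsign,
    coeff_mul_genericSum_pow_of_lt A u (Nat.lt_succ_self _), mul_zero, add_zero,
    Matrix.sum_apply, MvPolynomial.coeff_sum, gnt, Matrix.sum_apply]
  refine Finset.sum_congr rfl fun s _ => ?_
  rw [Matrix.smul_apply, Matrix.smul_apply, Matrix.smul_apply, smul_eq_mul, smul_eq_mul,
    smul_eq_mul, hsign, Matrix.sum_apply]
  exact congrArg _ (coeff_newtonMvPoly_mul_genericSum_pow A u s i j).symm

theorem trace_mul_gnt (A : Fin q → Matrix (Fin p) (Fin p) ℝ) (B : Matrix (Fin p) (Fin p) ℝ)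
    (u : Fin q → ℕ) :
    (B * gnt A u).trace = ((B.map MvPolynomial.C * (1 + genericSum A).adjugate).trace).coeff
      (Finsupp.equivFunOnFinite.symm u) := by
  simp [Matrix.trace, Matrix.mul_apply, MvPolynomial.coeff_sum, gnt_apply]

theorem euler_newtonMvPoly (A : Fin q → Matrix (Fin p) (Fin p) ℝ) :
    MvPolynomial.mkDerivation ℝ MvPolynomial.X (newtonMvPoly A) =
      (genericSum A * (1 + genericSum A).adjugate).trace := by
  have hmap : (1 + genericSum A).map (MvPolynomial.mkDerivation ℝ MvPolynomial.X) =
      genericSum A := by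
    ext1 i j
    simp [genericSum, Matrix.sum_apply, Matrix.one_apply, apply_ite, mul_comm]
  rw [show newtonMvPoly A = (1 + genericSum A).det from rfl, derivation_det, hmap]

theorem statement_6 (hq : 1 ≤ q) (A : Fin q → Matrix (Fin p) (Fin p) ℝ) (u : Fin q → ℕ) :
    ((∑ α, u α : ℕ) : ℝ) * sigma A u = ∑ α, Matrix.trace (A α * gntFlat A α u) := by
  have hdeg : ∑ α, u α = (Finsupp.equivFunOnFinite.symm u).degree := by
    rw [Finsupp.degree_eq_sum]
    rfl
  rw [hdeg, sigma, ← coeff_euler, euler_newtonMvPoly]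
  nth_rw 1 [genericSum]
  rw [Finset.sum_mul, Matrix.trace_sum, MvPolynomial.coeff_sum]
  refine Finset.sum_congr rfl fun α _ => ?_
  rw [Matrix.smul_mul, Matrix.trace_smul, smul_eq_mul, MvPolynomial.coeff_X_mul', gntFlat]
  by_cases h : u α = 0
  · simp [h]
  · rw [if_pos (by simpa using h), if_neg h, trace_mul_gnt]
    congr 1
    ext β
    by_cases hβ : β = α
    · subst hβ; simp
    · simp [hβ]

end GNTPaper
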